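/- Let ν be a measure on the unit sphere S^{n−1} concentrated on B_{[n]}, and let (ℱ_e, ℱ_o) with ℱ_e, ℱ_o ⊆ 𝒫([n]) be a proper generating pair. Then ν is spherically universal on the space ℳ(B_{[n]}; ℱ_e, ℱ_o) of measures concentrated on B_{[n]} that are even under T_F for all F ∈ ℱ_e and odd under T_F for all F ∈ ℱ_o, if and only if δ_J ⊛_S ν ≠ 0 for every J ∈ 𝒥(ℱ_e, ℱ_o). Moreover, in this case, if ν is even (odd) under T_E for some E ⊆ [n], then E ∈ 𝒢_e (respectively E ∈ 𝒢_o), where 𝒢 is the group generated by ℱ_e ∪ ℱ_o. -/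

import Mathlib

open MeasureTheory
open scoped ENNReal symmDiff Classical

noncomputable section

/-- The Euclidean (ℓ²) norm on `Fin n → ℝ`. -/
def e2 {n : ℕ} (x : Fin n → ℝ) : ℝ := Real.sqrt (∑ i, (x i) ^ 2)

/-- The unit sphere `S^{n-1}` in `ℝⁿ`. -/
def Sph (n : ℕ) : Set (Fin n → ℝ) := {x | e2 x = 1}

/-- The set `A_E = {x : xᵢ ≠ 0 ↔ i ∈ E}`. -/
def setA {n : ℕ} (E : Finset (Fin n)) : Set (Fin n → ℝ) := {x | ∀ i, x i ≠ 0 ↔ i ∈ E}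

/-- Finite signed Borel measures on `ℝⁿ`. -/
abbrev SM (n : ℕ) := MeasureTheory.SignedMeasure (Fin n → ℝ)

/-- A (finite) measure regarded as a signed measure (junk value `0` if not finite). -/
def toSigned {X : Type*} [MeasurableSpace X] (ρ : Measure X) : SignedMeasure X :=
  if h : IsFiniteMeasure ρ then @Measure.toSignedMeasure X _ ρ h else 0

/-- Multiplicative convolution of two non-negative measures. -/
def mconvPos {n : ℕ} (ρ σ : Measure (Fin n → ℝ)) : Measure (Fin n → ℝ) :=
  (ρ.prod σ).map (fun p => p.1 * p.2)

/-- Multiplicative convolution `μ ⊛ ν` of two signed measures, via Jordan decomposition. -/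
def mconv {n : ℕ} (μ ν : SM n) : SM n :=
  toSigned (mconvPos μ.toJordanDecomposition.posPart ν.toJordanDecomposition.posPart
      + mconvPos μ.toJordanDecomposition.negPart ν.toJordanDecomposition.negPart)
  - toSigned (mconvPos μ.toJordanDecomposition.posPart ν.toJordanDecomposition.negPart
      + mconvPos μ.toJordanDecomposition.negPart ν.toJordanDecomposition.posPart)

/-- `μ` is integrable: `∫ ‖x‖₂ d|μ| < ∞`. -/
def IntegrableSM {n : ℕ} (μ : SM n) : Prop :=
  ∫⁻ x, ENNReal.ofReal (e2 x) ∂μ.totalVariation < ⊤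

/-- `μ` is concentrated on `A`:  `|μ|(Aᶜ) = 0`. -/
def ConcOn {n : ℕ} (μ : SM n) (A : Set (Fin n → ℝ)) : Prop := μ.totalVariation Aᶜ = 0

/-- The multiple reflection `T_E` on `ℝⁿ`. -/
def flipE {n : ℕ} (E : Finset (Fin n)) (x : Fin n → ℝ) : Fin n → ℝ :=
  fun i => if i ∈ E then -x i else x i

/-- Pushforward of a signed measure under `T_E`. -/
def Tmap {n : ℕ} (E : Finset (Fin n)) (μ : SM n) : SM n := μ.map (flipE E)

def EvenUnder {n : ℕ} (μ : SM n) (E : Finset (Fin n)) : Prop := Tmap E μ = μ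
def OddUnder {n : ℕ} (μ : SM n) (E : Finset (Fin n)) : Prop := Tmap E μ = -μ

/-- Orthogonal projection onto the coordinate subspace `H_E`. -/
def projE {n : ℕ} (E : Finset (Fin n)) (x : Fin n → ℝ) : Fin n → ℝ :=
  fun i => if i ∈ E then x i else 0

/-- `P_E(μ)`: pushforward under `projE`. -/
def Pmap {n : ℕ} (E : Finset (Fin n)) (μ : SM n) : SM n := μ.map (projE E)

/-- `R_E(μ) = μ_E`: restriction to `A_E`. -/
def Rres {n : ℕ} (E : Finset (Fin n)) (μ : SM n) : SM n := μ.restrict (setA E)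

/-- Sign vector attached to `b : Fin n → Bool`. -/
def signVec {n : ℕ} (b : Fin n → Bool) : Fin n → ℝ := fun i => if b i then 1 else -1

/-- The measure `δ_J = 2^{-n} ∑_{s ∈ 𝒮ⁿ} σ_J(s) δ_s`. -/
def deltaJ {n : ℕ} (J : Finset (Fin n)) : SM n :=
  ((2 : ℝ) ^ n)⁻¹ •
    ∑ b : Fin n → Bool,
      (∏ j ∈ J, (if b j then (1 : ℝ) else -1)) • toSigned (Measure.dirac (signVec b))

/-- `𝒥(E; Fe, Fo)`. -/
def JsetE {n : ℕ} (E : Finset (Fin n)) (Fe Fo : Set (Finset (Fin n))) :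
    Set (Finset (Fin n)) :=
  {J | J ⊆ E ∧ (∀ F ∈ Fe, Even (J ∩ F).card) ∧ (∀ F ∈ Fo, Odd (J ∩ F).card)}

/-- `𝒥(Fe, Fo) = 𝒥([n]; Fe, Fo)`. -/
def Jset {n : ℕ} (Fe Fo : Set (Finset (Fin n))) : Set (Finset (Fin n)) :=
  {J | (∀ F ∈ Fe, Even (J ∩ F).card) ∧ (∀ F ∈ Fo, Odd (J ∩ F).card)}

/-- `G` has a representation `G = F₁ Δ … Δ F_m` with each `Fᵢ` drawn from `Fe` or `Fo`,
in which the number of terms drawn from `Fo` is even (`odd = false`) or odd (`odd = true`). -/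
def HasRep {n : ℕ} (Fe Fo : Set (Finset (Fin n))) (G : Finset (Fin n)) (odd : Bool) : Prop :=
  ∃ l : List (Finset (Fin n) × Bool),
    (∀ p ∈ l, if p.2 then p.1 ∈ Fo else p.1 ∈ Fe) ∧
    (l.map Prod.fst).foldr (· ∆ ·) ∅ = G ∧
    (l.countP (fun p => p.2)) % 2 = (if odd then 1 else 0)

/-- The generating pair `(Fe, Fo)` is proper: the even and odd parts of the generated group
are disjoint. -/
def ProperPair {n : ℕ} (Fe Fo : Set (Finset (Fin n))) : Prop :=
  ∀ G : Finset (Fin n), ¬ (HasRep Fe Fo G false ∧ HasRep Fe Fo G true)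

/-- `ℳ^int(A; Fe, Fo)`: integrable signed measures concentrated on `A`, even under `T_F`
for `F ∈ Fe` and odd under `T_F` for `F ∈ Fo`. -/
def MclassInt {n : ℕ} (A : Set (Fin n → ℝ)) (Fe Fo : Set (Finset (Fin n))) : Set (SM n) :=
  {μ | IntegrableSM μ ∧ ConcOn μ A ∧ (∀ F ∈ Fe, EvenUnder μ F) ∧ (∀ F ∈ Fo, OddUnder μ F)}

/-- `ν` is universal on `𝒜`. -/
def Universal {n : ℕ} (ν : SM n) (𝒜 : Set (SM n)) : Prop :=
  ∀ μ ∈ 𝒜, mconv ν μ = 0 → μ = 0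

/-- Radial projection of a non-negative measure. -/
def radPos {n : ℕ} (ρ : Measure (Fin n → ℝ)) : Measure (Fin n → ℝ) :=
  (ρ.withDensity fun x => ENNReal.ofReal (e2 x)).map (fun x => (e2 x)⁻¹ • x)

/-- Radial projection `P_S` of a signed measure. -/
def PS {n : ℕ} (μ : SM n) : SM n :=
  toSigned (radPos μ.toJordanDecomposition.posPart) -
    toSigned (radPos μ.toJordanDecomposition.negPart)

/-- The spherical product `μ ⊛_S ν = P_S(μ ⊛ ν)`. -/
def mconvS {n : ℕ} (μ ν : SM n) : SM n := PS (mconv μ ν)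

/-- `ν` is spherically universal on `𝒜`. -/
def SphUniversal {n : ℕ} (ν : SM n) (𝒜 : Set (SM n)) : Prop :=
  ∀ μ ∈ 𝒜, mconvS ν μ = 0 → μ = 0

/-- The unconditional symmetrisation `M_unc`. -/
def Munc {n : ℕ} (μ : SM n) : SM n := ((2 : ℝ) ^ n)⁻¹ • ∑ E : Finset (Fin n), Tmap E μ

/-- Integral of `f` against a signed measure. -/
def sInt {n : ℕ} (μ : SM n) (f : (Fin n → ℝ) → ℝ) : ℝ :=
  (∫ x, f x ∂μ.toJordanDecomposition.posPart) - ∫ x, f x ∂μ.toJordanDecomposition.negPart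

/-- `δ₁ ⊗ μ`: the lifting of `μ` to a measure on `ℝ^{n+1}`, with an extra `0`-th coordinate
carrying a unit atom at `1`. -/
def lift0 {n : ℕ} (μ : SM n) : SM (n + 1) := μ.map (fun x => Fin.cons 1 x)

/-- Symmetrisation about the origin. -/
def Msym {n : ℕ} (μ : SM n) : SM n := (2 : ℝ)⁻¹ • (μ + μ.map (fun x => -x))

/-- The lifting `L(μ) = P_S(M_sym(δ₁ ⊗ μ))`. -/
def Lift {n : ℕ} (μ : SM n) : SM (n + 1) := PS (Msym (lift0 μ))


/-- Bounded measurable complex-valued functions. -/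
def BddMeas {X : Type*} [MeasurableSpace X] (f : X → ℂ) : Prop :=
  Measurable f ∧ ∃ C : ℝ, ∀ x, ‖f x‖ ≤ C

/-- Integral of a complex-valued function against a signed measure. -/
def cInt {X : Type*} [MeasurableSpace X] (μ : SignedMeasure X) (f : X → ℂ) : ℂ :=
  (∫ x, f x ∂μ.toJordanDecomposition.posPart) - ∫ x, f x ∂μ.toJordanDecomposition.negPart

section Foundations

variable {X Y : Type*} [MeasurableSpace X] [MeasurableSpace Y]

theorem BddMeas.integrable {f : X → ℂ} (hf : BddMeas f) (p : Measure X) [IsFiniteMeasure p] :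
    Integrable f p := by
  obtain ⟨hm, C, hC⟩ := hf
  exact Integrable.of_bound hm.aestronglyMeasurable C (Filter.Eventually.of_forall hC)

theorem BddMeas.comp {f : Y → ℂ} (hf : BddMeas f) {g : X → Y} (hg : Measurable g) :
    BddMeas (fun x => f (g x)) :=
  ⟨hf.1.comp hg, hf.2.choose, fun x => hf.2.choose_spec (g x)⟩

theorem BddMeas.mul {f g : X → ℂ} (hf : BddMeas f) (hg : BddMeas g) :
    BddMeas (fun x => f x * g x) := by
  obtain ⟨hm, C, hC⟩ := hf
  obtain ⟨hm', C', hC'⟩ := hg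
  refine ⟨hm.mul hm', C * C', fun x => ?_⟩
  rw [norm_mul]
  exact mul_le_mul (hC x) (hC' x) (norm_nonneg _) ((norm_nonneg _).trans (hC x))

theorem BddMeas.const (c : ℂ) : BddMeas (fun _ : X => c) :=
  ⟨measurable_const, ‖c‖, fun _ => le_rfl⟩

theorem BddMeas.sum {ι : Type*} (s : Finset ι) {f : ι → X → ℂ} (hf : ∀ i ∈ s, BddMeas (f i)) :
    BddMeas (fun x => ∑ i ∈ s, f i x) := by
  choose! C hC using fun i hi => (hf i hi).2
  refine ⟨Finset.measurable_sum _ fun i hi => (hf i hi).1, ∑ i ∈ s, C i, fun x => ?_⟩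
  exact (norm_sum_le _ _).trans (Finset.sum_le_sum fun i hi => hC i hi x)

theorem BddMeas.indicator {f : X → ℂ} (hf : BddMeas f) {A : Set X} (hA : MeasurableSet A) :
    BddMeas (A.indicator f) :=
  ⟨hf.1.indicator hA, hf.2.choose,
    fun x => (norm_indicator_le_norm_self _ _).trans (hf.2.choose_spec x)⟩

theorem toSigned_eq (p : Measure X) [h : IsFiniteMeasure p] : toSigned p = p.toSignedMeasure :=
  dif_pos h

theorem eq_jordan_sub (μ : SignedMeasure X) :
    μ = toSigned μ.toJordanDecomposition.posPart - toSigned μ.toJordanDecomposition.negPart := by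
  rw [toSigned_eq, toSigned_eq]
  exact μ.toSignedMeasure_toJordanDecomposition.symm

theorem add_eq_add_of_toSigned_sub_eq {p q r s : Measure X} [IsFiniteMeasure p]
    [IsFiniteMeasure q] [IsFiniteMeasure r] [IsFiniteMeasure s]
    (h : toSigned p - toSigned q = toSigned r - toSigned s) : p + s = r + q := by
  rw [← Measure.toSignedMeasure_eq_toSignedMeasure_iff, Measure.toSignedMeasure_add, Measure.toSignedMeasure_add]
  simp only [toSigned_eq] at h
  rw [← sub_eq_sub_iff_add_eq_add]
  exact h

theorem cInt_eq {μ : SignedMeasure X} {p q : Measure X} [IsFiniteMeasure p] [IsFiniteMeasure q]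
    (h : μ = toSigned p - toSigned q) {f : X → ℂ} (hf : BddMeas f) :
    cInt μ f = ∫ x, f x ∂p - ∫ x, f x ∂q := by
  have h2 := add_eq_add_of_toSigned_sub_eq ((eq_jordan_sub μ).symm.trans h)
  have h3 := congrArg (fun m => ∫ x, f x ∂m) h2
  rw [integral_add_measure (hf.integrable _) (hf.integrable _),
    integral_add_measure (hf.integrable _) (hf.integrable _)] at h3
  rw [cInt, sub_eq_sub_iff_add_eq_add]
  exact h3

theorem cInt_indicator (μ : SignedMeasure X) {A : Set X} (hA : MeasurableSet A) :
    cInt μ (A.indicator 1) = μ A := by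
  have h := congrArg (fun m : SignedMeasure X => m A) (eq_jordan_sub μ)
  simp only [toSigned_eq, _root_.sub_apply, Measure.toSignedMeasure_apply_measurable hA] at h
  have h1 (p : Measure X) : ∫ x, A.indicator (1 : X → ℂ) x ∂p = (p.real A : ℂ) := by
    rw [integral_indicator hA]
    simp
  rw [h, cInt, h1, h1]
  push_cast
  rfl

theorem BddMeas.indicator_one {A : Set X} (hA : MeasurableSet A) :
    BddMeas (A.indicator (1 : X → ℂ)) :=
  BddMeas.indicator (BddMeas.const 1) hA

theorem eq_zero_of_cInt {μ : SignedMeasure X} (h : ∀ f, BddMeas f → cInt μ f = 0) : μ = 0 := by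
  ext A hA
  have := h _ (BddMeas.indicator_one hA)
  rw [cInt_indicator μ hA] at this
  exact_mod_cast this

theorem cInt_zero (f : X → ℂ) : cInt (0 : SignedMeasure X) f = 0 := by
  simp [cInt, SignedMeasure.toJordanDecomposition_zero]

theorem cInt_toSigned (p : Measure X) [IsFiniteMeasure p] {f : X → ℂ} (hf : BddMeas f) :
    cInt (toSigned p) f = ∫ x, f x ∂p := by
  rw [cInt_eq (p := p) (q := 0) (by simp [toSigned_eq]) hf]
  simp

theorem cInt_add (μ ν : SignedMeasure X) {f : X → ℂ} (hf : BddMeas f) :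
    cInt (μ + ν) f = cInt μ f + cInt ν f := by
  have h : μ + ν = toSigned (μ.toJordanDecomposition.posPart + ν.toJordanDecomposition.posPart) -
      toSigned (μ.toJordanDecomposition.negPart + ν.toJordanDecomposition.negPart) := by
    conv_lhs => rw [eq_jordan_sub μ, eq_jordan_sub ν]
    simp only [toSigned_eq, Measure.toSignedMeasure_add]
    abel
  rw [cInt_eq h hf, integral_add_measure (hf.integrable _) (hf.integrable _),
    integral_add_measure (hf.integrable _) (hf.integrable _), cInt, cInt]
  ring

theorem cInt_neg (μ : SignedMeasure X) (f : X → ℂ) : cInt (-μ) f = -cInt μ f := by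
  simp [cInt, SignedMeasure.toJordanDecomposition_neg]

theorem cInt_sum {ι : Type*} (s : Finset ι) (μ : ι → SignedMeasure X) {f : X → ℂ}
    (hf : BddMeas f) : cInt (∑ i ∈ s, μ i) f = ∑ i ∈ s, cInt (μ i) f := by
  induction s using Finset.induction_on with
  | empty => simp [cInt_zero]
  | insert a s ha ih => rw [Finset.sum_insert ha, Finset.sum_insert ha, cInt_add _ _ hf, ih]

theorem cInt_smul (c : ℝ) (μ : SignedMeasure X) (f : X → ℂ) :
    cInt (c • μ) f = c * cInt μ f := by
  rcases le_or_gt 0 c with hc | hc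
  · simp only [cInt, SignedMeasure.toJordanDecomposition_smul_real,
      JordanDecomposition.real_smul_posPart_nonneg _ _ hc,
      JordanDecomposition.real_smul_negPart_nonneg _ _ hc]
    rw [integral_smul_nnreal_measure, integral_smul_nnreal_measure, ← smul_sub, NNReal.smul_def,
      Real.coe_toNNReal _ hc, Complex.real_smul]
  · simp only [cInt, SignedMeasure.toJordanDecomposition_smul_real,
      JordanDecomposition.real_smul_posPart_neg _ _ hc,
      JordanDecomposition.real_smul_negPart_neg _ _ hc]
    rw [integral_smul_nnreal_measure, integral_smul_nnreal_measure, ← smul_sub, NNReal.smul_def,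
      Real.coe_toNNReal _ (by linarith), Complex.real_smul]
    push_cast
    ring

theorem cInt_map (μ : SignedMeasure X) {T : X → Y} (hT : Measurable T) {f : Y → ℂ}
    (hf : BddMeas f) : cInt (μ.map T) f = cInt μ (fun x => f (T x)) := by
  have h : μ.map T = toSigned (μ.toJordanDecomposition.posPart.map T) -
      toSigned (μ.toJordanDecomposition.negPart.map T) := by
    ext A hA
    have h := congrArg (fun m : SignedMeasure X => m (T ⁻¹' A)) (eq_jordan_sub μ)
    simp only [toSigned_eq, _root_.sub_apply,
      Measure.toSignedMeasure_apply_measurable (hT hA)] at h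
    rw [VectorMeasure.map_apply _ hT hA, h]
    simp only [toSigned_eq, _root_.sub_apply, Measure.toSignedMeasure_apply_measurable hA]
    rw [map_measureReal_apply hT hA, map_measureReal_apply hT hA]
  rw [cInt_eq h hf, integral_map hT.aemeasurable hf.1.aestronglyMeasurable,
    integral_map hT.aemeasurable hf.1.aestronglyMeasurable, cInt]

theorem cInt_mul_left (μ : SignedMeasure X) (c : ℂ) (f : X → ℂ) :
    cInt μ (fun x => c * f x) = c * cInt μ f := by
  simp only [cInt, integral_const_mul]
  ring

theorem cInt_finset_sum (μ : SignedMeasure X) {ι : Type*} (s : Finset ι) (f : ι → X → ℂ)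
    (hf : ∀ i ∈ s, BddMeas (f i)) :
    cInt μ (fun x => ∑ i ∈ s, f i x) = ∑ i ∈ s, cInt μ (f i) := by
  simp only [cInt]
  rw [integral_finsetSum _ fun i hi => (hf i hi).integrable _,
    integral_finsetSum _ fun i hi => (hf i hi).integrable _, Finset.sum_sub_distrib]

theorem ae_of_totalVariation {μ : SignedMeasure X} {S : Set X} (h : μ.totalVariation Sᶜ = 0) :
    (∀ᵐ x ∂μ.toJordanDecomposition.posPart, x ∈ S) ∧
      ∀ᵐ x ∂μ.toJordanDecomposition.negPart, x ∈ S := by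
  rw [SignedMeasure.totalVariation, Measure.coe_add, Pi.add_apply, add_eq_zero] at h
  exact h

theorem cInt_congr {μ : SignedMeasure X} {S : Set X} (h : μ.totalVariation Sᶜ = 0)
    {f g : X → ℂ} (hfg : ∀ x ∈ S, f x = g x) : cInt μ f = cInt μ g := by
  obtain ⟨h1, h2⟩ := ae_of_totalVariation h
  rw [cInt, cInt, integral_congr_ae (h1.mono hfg), integral_congr_ae (h2.mono hfg)]

theorem totalVariation_compl_eq_zero {μ : SignedMeasure X} {S : Set X} (hS : MeasurableSet S)
    (h : ∀ A, MeasurableSet A → Disjoint A S → μ A = 0) : μ.totalVariation Sᶜ = 0 := by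
  obtain ⟨i, hi, h1, h2, hp, hn⟩ := μ.toJordanDecomposition_spec
  rw [SignedMeasure.totalVariation, Measure.coe_add, Pi.add_apply, hp, hn,
    SignedMeasure.toMeasureOfZeroLE_apply _ h1 hi hS.compl,
    SignedMeasure.toMeasureOfLEZero_apply _ h2 hi.compl hS.compl]
  have e1 := h (i ∩ Sᶜ) (hi.inter hS.compl) (disjoint_compl_left.mono_left Set.inter_subset_right)
  have e2 := h (iᶜ ∩ Sᶜ) (hi.compl.inter hS.compl)
    (disjoint_compl_left.mono_left Set.inter_subset_right)
  simp [e1, e2]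

end Foundations

section SphericalProduct

variable {n : ℕ}

theorem measurable_e2 : Measurable (e2 : (Fin n → ℝ) → ℝ) := by
  unfold e2
  fun_prop

theorem e2_nonneg (x : Fin n → ℝ) : 0 ≤ e2 x := Real.sqrt_nonneg _

theorem e2_smul {c : ℝ} (hc : 0 ≤ c) (x : Fin n → ℝ) : e2 (c • x) = c * e2 x := by
  simp only [e2, Pi.smul_apply, smul_eq_mul, mul_pow, ← Finset.mul_sum]
  rw [Real.sqrt_mul (sq_nonneg c), Real.sqrt_sq hc]

theorem BddMeas.cInt_right {X Y : Type*} [MeasurableSpace X] [MeasurableSpace Y] {g : X × Y → ℂ}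
    (hg : BddMeas g) (ν : SignedMeasure Y) : BddMeas (fun x => cInt ν (fun y => g (x, y))) := by
  obtain ⟨hm, C, hC⟩ := hg
  refine ⟨?_, C * ν.toJordanDecomposition.posPart.real Set.univ +
    C * ν.toJordanDecomposition.negPart.real Set.univ, fun x => ?_⟩
  · exact (hm.stronglyMeasurable.integral_prod_right'
      (ν := ν.toJordanDecomposition.posPart)).measurable.sub
      (hm.stronglyMeasurable.integral_prod_right'
      (ν := ν.toJordanDecomposition.negPart)).measurable
  · refine (norm_sub_le _ _).trans (add_le_add ?_ ?_) <;>
    exact norm_integral_le_of_norm_le_const (Filter.Eventually.of_forall fun y => hC (x, y))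

/-- The integral of `f` against a multiplicative convolution is an iterated integral. -/
theorem cInt_mconv (μ ν : SM n) {f : (Fin n → ℝ) → ℂ} (hf : BddMeas f) :
    cInt (mconv μ ν) f = cInt μ (fun x => cInt ν (fun y => f (x * y))) := by
  have hmul : Measurable (fun p : (Fin n → ℝ) × (Fin n → ℝ) => p.1 * p.2) := by fun_prop
  have hF : BddMeas (fun p : (Fin n → ℝ) × (Fin n → ℝ) => f (p.1 * p.2)) := hf.comp hmul
  have hfin (p q : Measure (Fin n → ℝ)) [IsFiniteMeasure p] [IsFiniteMeasure q] :
      IsFiniteMeasure (mconvPos p q) := by unfold mconvPos; infer_instance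
  have key (p q : Measure (Fin n → ℝ)) [IsFiniteMeasure p] [IsFiniteMeasure q] :
      ∫ z, f z ∂(mconvPos p q) = ∫ x, ∫ y, f (x * y) ∂q ∂p := by
    unfold mconvPos
    rw [integral_map hmul.aemeasurable hf.1.aestronglyMeasurable,
      integral_prod _ (hF.integrable _)]
  rw [mconv, cInt_eq rfl hf, integral_add_measure (hf.integrable _) (hf.integrable _),
    integral_add_measure (hf.integrable _) (hf.integrable _), key, key, key, key]
  have hi (p q : Measure (Fin n → ℝ)) [IsFiniteMeasure p] [IsFiniteMeasure q] :
      Integrable (fun x => ∫ y, f (x * y) ∂q) p := (hF.integrable (p.prod q)).integral_prod_left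
  simp only [cInt]
  rw [integral_sub (hi _ _) (hi _ _), integral_sub (hi _ _) (hi _ _)]
  ring

/-- The degree-one homogeneous extension of `f`, cut off outside the unit ball. -/
def homExt (f : (Fin n → ℝ) → ℂ) (z : Fin n → ℝ) : ℂ :=
  {z : Fin n → ℝ | e2 z ≤ 1}.indicator (fun z => (e2 z : ℂ) * f ((e2 z)⁻¹ • z)) z

theorem measurableSet_e2_le_one : MeasurableSet {z : Fin n → ℝ | e2 z ≤ 1} :=
  measurable_e2 measurableSet_Iic

theorem measurable_normalize : Measurable (fun z : Fin n → ℝ => (e2 z)⁻¹ • z) :=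
  measurable_e2.inv.smul measurable_id

theorem BddMeas.homExt {f : (Fin n → ℝ) → ℂ} (hf : BddMeas f) : BddMeas (homExt f) := by
  obtain ⟨hm, C, hC⟩ := hf
  refine ⟨Measurable.indicator ?_ measurableSet_e2_le_one, C, fun z => ?_⟩
  · exact (Complex.measurable_ofReal.comp measurable_e2).mul (hm.comp measurable_normalize)
  · have hC0 : 0 ≤ C := (norm_nonneg _).trans (hC z)
    by_cases hz : e2 z ≤ 1
    · rw [_root_.homExt, Set.indicator_of_mem (by exact hz), norm_mul, Complex.norm_real,
        Real.norm_of_nonneg (e2_nonneg z)]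
      calc e2 z * _ ≤ 1 * C := mul_le_mul hz (hC _) (norm_nonneg _) zero_le_one
        _ = C := one_mul C
    · rw [_root_.homExt, Set.indicator_of_notMem (by exact hz)]
      simpa using hC0

theorem cInt_PS {ρ : SM n} (hρ : ρ.totalVariation {z | e2 z ≤ 1}ᶜ = 0) {f : (Fin n → ℝ) → ℂ}
    (hf : BddMeas f) : cInt (PS ρ) f = cInt ρ (homExt f) := by
  obtain ⟨hp, hn⟩ := ae_of_totalVariation hρ
  have hfin (p : Measure (Fin n → ℝ)) [IsFiniteMeasure p] (h : ∀ᵐ z ∂p, z ∈ {z | e2 z ≤ 1}) :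
      IsFiniteMeasure (radPos p) := by
    have : IsFiniteMeasure (p.withDensity fun x => ENNReal.ofReal (e2 x)) := by
      refine isFiniteMeasure_withDensity (ne_of_lt ?_)
      refine lt_of_le_of_lt (lintegral_mono_ae (g := fun _ => 1) ?_) ?_
      · exact h.mono fun z hz => by simpa using hz
      · simp
    unfold radPos
    infer_instance
  have key (p : Measure (Fin n → ℝ)) (h : ∀ᵐ z ∂p, z ∈ {z | e2 z ≤ 1}) :
      ∫ z, f z ∂(radPos p) = ∫ z, homExt f z ∂p := by
    unfold radPos
    rw [integral_map measurable_normalize.aemeasurable hf.1.aestronglyMeasurable,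
      integral_withDensity_eq_integral_toReal_smul (by exact measurable_e2.ennreal_ofReal)
        (Filter.Eventually.of_forall fun _ => ENNReal.ofReal_lt_top)]
    refine integral_congr_ae (h.mono fun z hz => ?_)
    simp only [homExt]
    rw [Set.indicator_of_mem hz, ENNReal.toReal_ofReal (e2_nonneg z), Complex.real_smul]
  have := hfin _ hp
  have := hfin _ hn
  rw [PS, cInt_eq rfl hf, key _ hp, key _ hn, cInt]

theorem cInt_mconvS {μ ν : SM n} {S T : Set (Fin n → ℝ)} (hμ : ConcOn μ S) (hν : ConcOn ν T)
    (hST : ∀ x ∈ S, ∀ y ∈ T, e2 (x * y) ≤ 1) {f : (Fin n → ℝ) → ℂ} (hf : BddMeas f) :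
    cInt (mconvS μ ν) f = cInt μ (fun x => cInt ν (fun y => homExt f (x * y))) := by
  rw [mconvS, cInt_PS _ hf, cInt_mconv _ _ hf.homExt]
  refine totalVariation_compl_eq_zero measurableSet_e2_le_one fun A hA hd => ?_
  have h : cInt (mconv μ ν) (A.indicator 1) = 0 := by
    rw [cInt_mconv _ _ (BddMeas.indicator_one hA)]
    rw [cInt_congr hμ (g := fun _ => 0)]
    · simp [cInt]
    · intro x hx
      rw [cInt_congr hν (g := fun _ => 0)]
      · simp [cInt]
      · intro y hy
        refine Set.indicator_of_notMem (fun hxy => ?_) _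
        exact Set.disjoint_left.1 hd hxy (hST x hx y hy)
  rw [cInt_indicator _ hA] at h
  exact_mod_cast h

/-! ### Signs -/

/-- The character `σ_J` of a sign pattern, extended to all vectors. -/
def sgnJ (J : Finset (Fin n)) (x : Fin n → ℝ) : ℂ := ∏ j ∈ J, ((x j / |x j| : ℝ) : ℂ)

/-- The sphere with the coordinate hyperplanes removed. -/
abbrev Breg (n : ℕ) : Set (Fin n → ℝ) := setA (Finset.univ : Finset (Fin n)) ∩ Sph n

theorem ne_zero_of_mem_Breg {x : Fin n → ℝ} (hx : x ∈ Breg n) (i : Fin n) : x i ≠ 0 :=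
  (hx.1 i).2 (Finset.mem_univ i)

theorem e2_of_mem_Breg {x : Fin n → ℝ} (hx : x ∈ Breg n) : e2 x = 1 := hx.2

theorem abs_le_of_mem_Breg {x : Fin n → ℝ} (hx : x ∈ Breg n) (i : Fin n) : |x i| ≤ 1 := by
  have h : e2 x = 1 := hx.2
  rw [e2, Real.sqrt_eq_one] at h
  rw [← sq_le_one_iff_abs_le_one, ← h]
  exact Finset.single_le_sum (f := fun i => x i ^ 2) (fun i _ => sq_nonneg _) (Finset.mem_univ i)

theorem e2_mul_le {x y : Fin n → ℝ} (hx : ∀ i, |x i| ≤ 1) : e2 (x * y) ≤ e2 y := by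
  refine Real.sqrt_le_sqrt (Finset.sum_le_sum fun i _ => ?_)
  rw [Pi.mul_apply, mul_pow]
  exact mul_le_of_le_one_left (sq_nonneg _) ((sq_le_one_iff_abs_le_one _).2 (hx i))

theorem measurableSet_Breg : MeasurableSet (Breg n) := by
  refine MeasurableSet.inter ?_ (measurable_e2 (measurableSet_singleton 1))
  have : setA (Finset.univ : Finset (Fin n)) = ⋂ i, {x : Fin n → ℝ | x i ≠ 0} := by
    ext x
    simp [setA]
  rw [this]
  exact MeasurableSet.iInter fun i => (measurable_pi_apply i) (measurableSet_singleton 0).compl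

theorem abs_signVec (b : Fin n → Bool) (i : Fin n) : |signVec b i| = 1 := by
  unfold signVec
  split_ifs <;> simp

theorem signVec_ne_zero (b : Fin n → Bool) (i : Fin n) : signVec b i ≠ 0 := by
  unfold signVec
  split_ifs <;> simp

theorem e2_signVec_mul (b : Fin n → Bool) (x : Fin n → ℝ) : e2 (signVec b * x) = e2 x := by
  unfold e2
  congr 1
  refine Finset.sum_congr rfl fun i _ => ?_
  rw [Pi.mul_apply, mul_pow, ← sq_abs (signVec b i), abs_signVec]
  ring

theorem sgnJ_signVec (J : Finset (Fin n)) (b : Fin n → Bool) :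
    sgnJ J (signVec b) = ((∏ j ∈ J, (if b j then (1 : ℝ) else -1) : ℝ) : ℂ) := by
  rw [sgnJ, Complex.ofReal_prod]
  refine Finset.prod_congr rfl fun j _ => ?_
  rw [abs_signVec, div_one]
  rfl

theorem sgnJ_mul (J : Finset (Fin n)) (x y : Fin n → ℝ) :
    sgnJ J (x * y) = sgnJ J x * sgnJ J y := by
  rw [sgnJ, sgnJ, sgnJ, ← Finset.prod_mul_distrib]
  refine Finset.prod_congr rfl fun j _ => ?_
  rw [Pi.mul_apply, abs_mul, mul_div_mul_comm, Complex.ofReal_mul]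

theorem norm_sgnJ_le (J : Finset (Fin n)) (x : Fin n → ℝ) : ‖sgnJ J x‖ ≤ 1 := by
  rw [sgnJ, norm_prod]
  refine Finset.prod_le_one (fun _ _ => norm_nonneg _) fun j _ => ?_
  rw [Complex.norm_real, Real.norm_eq_abs, abs_div, abs_abs]
  exact div_self_le_one _

theorem sgnJ_bddMeas (J : Finset (Fin n)) : BddMeas (sgnJ J) := by
  refine ⟨?_, 1, norm_sgnJ_le J⟩
  unfold sgnJ
  refine Finset.measurable_prod _ fun j _ => ?_
  fun_prop

theorem sgnJ_smul (J : Finset (Fin n)) {c : ℝ} (hc : 0 < c) (x : Fin n → ℝ) :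
    sgnJ J (c • x) = sgnJ J x := by
  refine Finset.prod_congr rfl fun j _ => ?_
  rw [Pi.smul_apply, smul_eq_mul, abs_mul, abs_of_pos hc, mul_div_mul_left _ _ hc.ne']

theorem sgnJ_mul_self (J : Finset (Fin n)) {x : Fin n → ℝ} (hx : ∀ i, x i ≠ 0) :
    sgnJ J x * sgnJ J x = 1 := by
  rw [← sgnJ_mul]
  refine Finset.prod_eq_one fun j _ => ?_
  rw [Pi.mul_apply, abs_mul_self, div_self (mul_self_ne_zero.2 (hx j)), Complex.ofReal_one]

/-- The coordinatewise absolute value. -/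
def absV (x : Fin n → ℝ) : Fin n → ℝ := fun i => |x i|

theorem measurable_absV : Measurable (absV : (Fin n → ℝ) → _) := by
  unfold absV
  fun_prop

theorem absV_signVec_mul (b : Fin n → Bool) (x : Fin n → ℝ) : absV (signVec b * x) = absV x := by
  ext i
  simp [absV, abs_mul, abs_signVec]

/-- The sign pattern of a vector. -/
def signOf (x : Fin n → ℝ) : Fin n → Bool := fun i => decide (0 ≤ x i)

theorem signVec_signOf_mul_absV (x : Fin n → ℝ) : signVec (signOf x) * absV x = x := by
  ext i
  by_cases h : 0 ≤ x i
  · simp [signVec, signOf, absV, h, abs_of_nonneg h]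
  · simp [signVec, signOf, absV, h, abs_of_neg (not_le.1 h)]

theorem signVec_mul_signVec (b c : Fin n → Bool) :
    signVec b * signVec c = signVec (fun i => b i == c i) := by
  ext i
  by_cases hb : b i = true <;> by_cases hc : c i = true <;> simp [signVec, hb, hc]

theorem sum_signVec_mul {M : Type*} [AddCommMonoid M] (c : Fin n → Bool)
    (F : (Fin n → ℝ) → M) : ∑ b, F (signVec b) = ∑ b, F (signVec b * signVec c) := by
  have hinv : Function.Involutive (fun (b : Fin n → Bool) (i : Fin n) => b i == c i) := by
    intro b
    ext i
    simp only
    cases b i <;> cases c i <;> rfl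
  rw [← Equiv.sum_comp hinv.toPerm]
  refine Finset.sum_congr rfl fun b _ => ?_
  rw [signVec_mul_signVec]
  rfl

theorem flipE_eq (E : Finset (Fin n)) (x : Fin n → ℝ) :
    flipE E x = signVec (fun i => decide (i ∉ E)) * x := by
  ext i
  by_cases h : i ∈ E <;> simp [flipE, signVec, h]

theorem measurable_flipE (E : Finset (Fin n)) : Measurable (flipE E) := by
  have : flipE E = fun x => signVec (fun i => decide (i ∉ E)) * x := funext (flipE_eq E)
  rw [this]
  fun_prop

theorem sgnJ_flip (J E : Finset (Fin n)) :
    sgnJ J (signVec fun i => decide (i ∉ E)) = (-1) ^ (J ∩ E).card := by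
  rw [sgnJ_signVec]
  push_cast
  have h (j : Fin n) : ((if (decide (j ∉ E) : Bool) = true then (1 : ℝ) else -1 : ℝ) : ℂ) =
      if j ∈ E then -1 else 1 := by
    by_cases h : j ∈ E <;> simp [h]
  simp only [h]
  rw [Finset.prod_ite, Finset.prod_const, Finset.prod_const_one, mul_one, Finset.filter_mem_eq_inter]

end SphericalProduct

section Components

variable {n : ℕ}

/-- The measure `δ_J` dilated by `c`. -/
def dilatedDeltaJ (c : ℝ) (J : Finset (Fin n)) : SM n :=
  ((2 : ℝ) ^ n)⁻¹ •
    ∑ b : Fin n → Bool,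
      (∏ j ∈ J, (if b j then (1 : ℝ) else -1)) • toSigned (Measure.dirac (c • signVec b))

theorem deltaJ_eq (J : Finset (Fin n)) : deltaJ J = dilatedDeltaJ 1 J := by
  simp only [deltaJ, dilatedDeltaJ, one_smul]

theorem cInt_dilatedDeltaJ (c : ℝ) (J : Finset (Fin n)) {f : (Fin n → ℝ) → ℂ} (hf : BddMeas f) :
    cInt (dilatedDeltaJ c J) f =
      ((2 : ℂ) ^ n)⁻¹ * ∑ b, sgnJ J (signVec b) * f (c • signVec b) := by
  rw [dilatedDeltaJ, cInt_smul, cInt_sum _ _ hf]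
  congr 1
  · push_cast
    rfl
  · refine Finset.sum_congr rfl fun b _ => ?_
    rw [cInt_smul, sgnJ_signVec, cInt_toSigned _ hf, integral_dirac' _ _ hf.1.stronglyMeasurable]

theorem concOn_dilatedDeltaJ (c : ℝ) (J : Finset (Fin n)) :
    ConcOn (dilatedDeltaJ c J) (Set.range fun b : Fin n → Bool => c • signVec b) := by
  refine totalVariation_compl_eq_zero (Set.finite_range _).measurableSet fun A hA hd => ?_
  have h := cInt_dilatedDeltaJ c J (BddMeas.indicator_one hA)
  rw [cInt_indicator _ hA, Finset.sum_eq_zero, mul_zero] at h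
  · exact_mod_cast h
  · intro b _
    rw [Set.indicator_of_notMem (Set.disjoint_right.1 hd ⟨b, rfl⟩), mul_zero]

/-- The `σ_J`-isotypic part of a function under sign changes. -/
def twist (J : Finset (Fin n)) (F : (Fin n → ℝ) → ℂ) (y : Fin n → ℝ) : ℂ :=
  ((2 : ℂ) ^ n)⁻¹ * ∑ b, sgnJ J (signVec b) * F (signVec b * y)

theorem BddMeas.twist {F : (Fin n → ℝ) → ℂ} (hF : BddMeas F) (J : Finset (Fin n)) :
    BddMeas (twist J F) := by
  refine (BddMeas.const _).mul (BddMeas.sum _ fun b _ => (BddMeas.const _).mul (hF.comp ?_))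
  fun_prop

theorem twist_eq (J : Finset (Fin n)) (F : (Fin n → ℝ) → ℂ) {y : Fin n → ℝ}
    (hy : ∀ i, y i ≠ 0) : twist J F y = sgnJ J y * twist J F (absV y) := by
  have h1 : sgnJ J (absV y) = 1 := by
    refine Finset.prod_eq_one fun j _ => ?_
    rw [absV, abs_abs, div_self (abs_ne_zero.2 (hy j)), Complex.ofReal_one]
  have h2 : sgnJ J y = sgnJ J (signVec (signOf y)) := by
    conv_lhs => rw [← signVec_signOf_mul_absV y, sgnJ_mul, h1, mul_one]
  rw [twist, twist, sum_signVec_mul (signOf y) fun s => sgnJ J s * F (s * absV y),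
    mul_left_comm, Finset.mul_sum _ _ (sgnJ J y)]
  congr 1
  refine Finset.sum_congr rfl fun b _ => ?_
  rw [mul_assoc (signVec b), signVec_signOf_mul_absV, sgnJ_mul, ← h2]
  linear_combination (-(sgnJ J (signVec b) * F (signVec b * y))) * sgnJ_mul_self J hy

theorem sum_sgnJ_signVec (b : Fin n → Bool) :
    ∑ J, sgnJ J (signVec b) = if b = fun _ => true then (2 : ℂ) ^ n else 0 := by
  have h := Finset.prod_one_add (f := fun i => ((signVec b i / |signVec b i| : ℝ) : ℂ))
    (Finset.univ : Finset (Fin n))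
  rw [Finset.powerset_univ] at h
  simp only [sgnJ]
  rw [← h]
  simp only [abs_signVec, div_one]
  split_ifs with hb
  · subst hb
    simp [signVec]
    norm_num
  · obtain ⟨i, hi⟩ : ∃ i, b i ≠ true := by
      by_contra! hc
      exact hb (funext hc)
    exact Finset.prod_eq_zero (Finset.mem_univ i) (by simp [signVec, hi])

theorem sum_twist (F : (Fin n → ℝ) → ℂ) (y : Fin n → ℝ) : ∑ J, twist J F y = F y := by
  simp only [twist]
  rw [← Finset.mul_sum, Finset.sum_comm]
  simp only [← Finset.sum_mul, sum_sgnJ_signVec, ite_mul, zero_mul]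
  rw [Finset.sum_ite_eq' Finset.univ (fun _ => true), if_pos (Finset.mem_univ _),
    inv_mul_cancel_left₀ (pow_ne_zero _ two_ne_zero)]
  congr 1
  ext i
  simp [signVec]

/-- The `σ_J`-component of `μ` vanishes. -/
def NullComp (μ : SM n) (J : Finset (Fin n)) : Prop :=
  ∀ h, BddMeas h → cInt μ (fun x => sgnJ J x * h (absV x)) = 0

theorem eq_zero_of_nullComp {μ : SM n} (hμ : ConcOn μ (Breg n)) (h : ∀ J, NullComp μ J) :
    μ = 0 := by
  refine eq_zero_of_cInt fun f hf => ?_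
  have e : f = fun x => ∑ J, twist J f x := funext fun x => (sum_twist f x).symm
  rw [e, cInt_finset_sum _ _ _ fun J _ => hf.twist J]
  refine Finset.sum_eq_zero fun J _ => ?_
  rw [cInt_congr hμ fun x hx => twist_eq J f (ne_zero_of_mem_Breg hx)]
  exact h J _ (hf.twist J)

theorem cInt_mconvS_deltaJ {ν : SM n} (hν : ConcOn ν (Breg n)) (J : Finset (Fin n))
    {f : (Fin n → ℝ) → ℂ} (hf : BddMeas f) :
    cInt (mconvS (deltaJ J) ν) f = cInt ν (twist J (homExt f)) := by
  have hmul : Measurable (fun p : (Fin n → ℝ) × (Fin n → ℝ) => p.1 * p.2) := by fun_prop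
  have hb (b : Fin n → Bool) : BddMeas fun y => homExt f (signVec b * y) :=
    hf.homExt.comp (by fun_prop)
  rw [deltaJ_eq, cInt_mconvS (concOn_dilatedDeltaJ 1 J) hν _ hf,
    cInt_dilatedDeltaJ _ _ ((hf.homExt.comp hmul).cInt_right ν)]
  · have e : twist J (homExt f) = fun y => ((2 : ℂ) ^ n)⁻¹ *
        ∑ b, sgnJ J (signVec b) * homExt f (signVec b * y) := rfl
    rw [e, cInt_mul_left, cInt_finset_sum _ _ _ fun b _ => (BddMeas.const _).mul (hb b)]
    simp only [one_smul, cInt_mul_left]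
  · rintro _ ⟨b, rfl⟩ y hy
    beta_reduce
    rw [one_smul, e2_signVec_mul]
    exact (e2_of_mem_Breg hy).le

theorem mconvS_deltaJ_eq_zero {ν : SM n} (hν : ConcOn ν (Breg n)) {J : Finset (Fin n)}
    (h : NullComp ν J) : mconvS (deltaJ J) ν = 0 := by
  refine eq_zero_of_cInt fun f hf => ?_
  rw [cInt_mconvS_deltaJ hν J hf, cInt_congr hν fun x hx => twist_eq J _ (ne_zero_of_mem_Breg hx)]
  exact h _ (hf.homExt.twist J)

theorem homExt_smul {c : ℝ} (hc : 0 < c) (hc1 : c ≤ 1) {f : (Fin n → ℝ) → ℂ} {z : Fin n → ℝ}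
    (hz : e2 z ≤ 1) : homExt f (c • z) = c * homExt f z := by
  have h : e2 (c • z) ≤ 1 := by
    rw [e2_smul hc.le]
    exact mul_le_one₀ hc1 (e2_nonneg z) hz
  rw [homExt, homExt, Set.indicator_of_mem (by exact h), Set.indicator_of_mem (by exact hz),
    e2_smul hc.le, smul_smul, mul_inv, mul_comm c⁻¹, mul_assoc _ c⁻¹, inv_mul_cancel₀ hc.ne',
    mul_one]
  push_cast
  ring

theorem mconvS_dilatedDeltaJ_eq_zero {ν : SM n} (hν : ConcOn ν (Breg n)) {J : Finset (Fin n)}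
    (h : mconvS (deltaJ J) ν = 0) {c : ℝ} (hc : 0 < c) (hc1 : c ≤ 1) :
    mconvS ν (dilatedDeltaJ c J) = 0 := by
  refine eq_zero_of_cInt fun f hf => ?_
  have h0 := cInt_mconvS_deltaJ hν J hf
  rw [h, cInt_zero] at h0
  rw [cInt_mconvS hν (concOn_dilatedDeltaJ c J) _ hf,
    cInt_congr hν (g := fun x => c * twist J (homExt f) x), cInt_mul_left, ← h0, mul_zero]
  · intro x hx
    rw [cInt_dilatedDeltaJ _ _ (hf.homExt.comp (by fun_prop)), twist, mul_left_comm (c : ℂ),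
      Finset.mul_sum _ _ (c : ℂ)]
    congr 1
    refine Finset.sum_congr rfl fun b _ => ?_
    rw [mul_smul_comm, homExt_smul hc hc1, mul_comm x]
    · ring
    · rw [mul_comm, e2_signVec_mul]
      exact (e2_of_mem_Breg hx).le
  · rintro x hx _ ⟨b, rfl⟩
    beta_reduce
    rw [mul_smul_comm, e2_smul hc.le, mul_comm x, e2_signVec_mul, (e2_of_mem_Breg hx), mul_one]
    exact hc1

theorem dilatedDeltaJ_ne_zero {c : ℝ} (hc : 0 < c) (J : Finset (Fin n)) :
    dilatedDeltaJ c J ≠ 0 := by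
  intro h
  have h1 := cInt_dilatedDeltaJ c J (sgnJ_bddMeas J)
  simp only [h, cInt_zero, sgnJ_smul J hc, sgnJ_mul_self J (signVec_ne_zero _)] at h1
  simp at h1

theorem eq_of_cInt {μ ν : SM n} (h : ∀ f, BddMeas f → cInt μ f = cInt ν f) : μ = ν := by
  rw [← sub_eq_zero, sub_eq_add_neg]
  refine eq_zero_of_cInt fun f hf => ?_
  rw [cInt_add _ _ hf, cInt_neg, h f hf, add_neg_cancel]

theorem cInt_Tmap_dilatedDeltaJ (c : ℝ) (J F : Finset (Fin n)) {f : (Fin n → ℝ) → ℂ}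
    (hf : BddMeas f) : cInt (Tmap F (dilatedDeltaJ c J)) f =
      (-1) ^ (J ∩ F).card * cInt (dilatedDeltaJ c J) f := by
  rw [Tmap, cInt_map _ (measurable_flipE F) hf,
    cInt_dilatedDeltaJ _ _ (hf.comp (measurable_flipE F)), cInt_dilatedDeltaJ _ _ hf,
    mul_left_comm, sum_signVec_mul (fun i => decide (i ∉ F)) fun s => sgnJ J s * f (c • s),
    Finset.mul_sum _ _ ((-1) ^ _ : ℂ)]
  congr 1
  refine Finset.sum_congr rfl fun b _ => ?_
  rw [flipE_eq, mul_smul_comm, mul_comm (signVec fun _ => _), sgnJ_mul, sgnJ_flip]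
  have : ((-1 : ℂ) ^ (J ∩ F).card) * (-1) ^ (J ∩ F).card = 1 := by
    rw [← mul_pow]
    simp
  linear_combination (-(sgnJ J (signVec b) * f (c • (signVec b * signVec fun i => decide (i ∉ F)))))
    * this

theorem evenUnder_dilatedDeltaJ (c : ℝ) {J F : Finset (Fin n)} (h : Even (J ∩ F).card) :
    EvenUnder (dilatedDeltaJ c J) F :=
  eq_of_cInt fun f hf => by rw [cInt_Tmap_dilatedDeltaJ c J F hf, h.neg_one_pow, one_mul]

theorem oddUnder_dilatedDeltaJ (c : ℝ) {J F : Finset (Fin n)} (h : Odd (J ∩ F).card) :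
    OddUnder (dilatedDeltaJ c J) F :=
  eq_of_cInt fun f hf => by
    rw [cInt_Tmap_dilatedDeltaJ c J F hf, h.neg_one_pow, cInt_neg, neg_one_mul]

theorem concOn_Breg_dilatedDeltaJ (hn : 1 ≤ n) (J : Finset (Fin n)) :
    ConcOn (dilatedDeltaJ (Real.sqrt n)⁻¹ J) (Breg n) := by
  refine measure_mono_null (Set.compl_subset_compl.2 ?_) (concOn_dilatedDeltaJ _ J)
  have hpos : 0 < Real.sqrt n := Real.sqrt_pos.2 (by exact_mod_cast hn)
  rintro _ ⟨b, rfl⟩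
  refine ⟨fun i => ?_, ?_⟩
  · simpa using ⟨Nat.one_le_iff_ne_zero.1 hn, signVec_ne_zero b i⟩
  · change e2 _ = 1
    have h := e2_signVec_mul b 1
    rw [mul_one] at h
    rw [e2_smul (inv_nonneg.2 hpos.le), h, e2]
    have hn0 : n ≠ 0 := Nat.one_le_iff_ne_zero.1 hn
    simp [hn0]

theorem nullComp_of_map {μ : SM n} {J E : Finset (Fin n)} {ε : ℂ} (hε : ε ≠ (-1) ^ (J ∩ E).card)
    (h : ∀ f, BddMeas f → cInt (Tmap E μ) f = ε * cInt μ f) : NullComp μ J := by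
  intro k hk
  have hb := (sgnJ_bddMeas J).mul (hk.comp measurable_absV)
  have h1 := h _ hb
  rw [Tmap, cInt_map _ (measurable_flipE E) hb] at h1
  simp only [flipE_eq, sgnJ_mul, sgnJ_flip, absV_signVec_mul, mul_assoc] at h1
  rw [cInt_mul_left, ← sub_eq_zero, ← sub_mul, mul_eq_zero, sub_eq_zero] at h1
  exact h1.resolve_left hε.symm

theorem nullComp_of_even {μ : SM n} {J E : Finset (Fin n)} (h : EvenUnder μ E)
    (hJ : Odd (J ∩ E).card) : NullComp μ J :=
  nullComp_of_map (E := E) (ε := 1) (by rw [hJ.neg_one_pow]; norm_num)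
    fun f _ => by rw [h, one_mul]

theorem nullComp_of_odd {μ : SM n} {J E : Finset (Fin n)} (h : OddUnder μ E)
    (hJ : Even (J ∩ E).card) : NullComp μ J :=
  nullComp_of_map (E := E) (ε := -1) (by rw [hJ.neg_one_pow]; norm_num)
    fun f _ => by rw [h, cInt_neg, neg_one_mul]

end Components

section Mellin

variable {n : ℕ}

theorem differentiableOn_integral_of_bounded {X : Type*} [MeasurableSpace X] {p : Measure X}
    [IsFiniteMeasure p] {U : Set ℂ} (hU : IsOpen U) {F F' : ℂ → X → ℂ} {C : ℝ}
    (hF : ∀ z, Measurable (F z)) (hF' : ∀ z, Measurable (F' z))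
    (hC : ∀ z ∈ U, ∀ x, ‖F z x‖ ≤ C) (hd : ∀ z x, HasDerivAt (fun z => F z x) (F' z x) z) :
    DifferentiableOn ℂ (fun z => ∫ x, F z x ∂p) U := by
  intro z₀ hz₀
  obtain ⟨r, hr, hball⟩ := Metric.isOpen_iff.1 hU z₀ hz₀
  have hr2 : 0 < r / 3 := by positivity
  refine (hasDerivAt_integral_of_dominated_loc_of_deriv_le (F' := F') (s := Metric.ball z₀ (r / 3))
    (bound := fun _ => C / (r / 3)) (Metric.ball_mem_nhds z₀ hr2)
    (Filter.Eventually.of_forall fun z => (hF z).aestronglyMeasurable)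
    (Integrable.of_bound (hF z₀).aestronglyMeasurable C
      (Filter.Eventually.of_forall fun x => hC z₀ hz₀ x))
    (hF' z₀).aestronglyMeasurable (Filter.Eventually.of_forall fun x z hz => ?_)
    (integrable_const _)
    (Filter.Eventually.of_forall fun x z _ => hd z x)).2.differentiableAt.differentiableWithinAt
  rw [← (hd z x).deriv]
  refine Complex.norm_deriv_le_of_forall_mem_sphere_norm_le hr2 ?_ fun w hw => hC w (hball ?_) x
  · exact Differentiable.diffContOnCl fun w => (hd w x).differentiableAt
  · rw [Metric.mem_ball] at hz ⊢
    rw [Metric.mem_sphere] at hw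
    calc dist w z₀ ≤ dist w z + dist z z₀ := dist_triangle _ _ _
      _ < r := by linarith

/-- The multi-index power `∏ᵢ |xᵢ|^{tᵢ}`, for vectors without zero coordinates. -/
def multiPow (t : Fin n → ℂ) (x : Fin n → ℝ) : ℂ := Complex.exp (∑ i, t i * (Real.log (x i) : ℂ))

/-- The Mellin kernel attached to `J` and `t`, living on the regular part of the sphere. -/
def mellinKernel (J : Finset (Fin n)) (t : Fin n → ℂ) : (Fin n → ℝ) → ℂ :=
  (Breg n).indicator fun x => sgnJ J x * multiPow t x

theorem measurable_multiPow (t : Fin n → ℂ) : Measurable (multiPow t) := by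
  unfold multiPow
  refine Complex.measurable_exp.comp (Finset.measurable_sum _ fun i _ => ?_)
  exact (Complex.measurable_ofReal.comp
    (Real.measurable_log.comp (measurable_pi_apply i))).const_mul _

theorem log_nonpos_of_mem_Breg {x : Fin n → ℝ} (hx : x ∈ Breg n) (i : Fin n) :
    Real.log (x i) ≤ 0 := by
  rw [← Real.log_abs]
  exact Real.log_nonpos (abs_nonneg _) (abs_le_of_mem_Breg hx i)

theorem norm_multiPow_le {t : Fin n → ℂ} (ht : ∀ i, 0 ≤ (t i).re) {x : Fin n → ℝ}
    (hx : x ∈ Breg n) : ‖multiPow t x‖ ≤ 1 := by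
  rw [multiPow, Complex.norm_exp, Real.exp_le_one_iff, Complex.re_sum]
  refine Finset.sum_nonpos fun i _ => ?_
  rw [Complex.re_mul_ofReal]
  exact mul_nonpos_of_nonneg_of_nonpos (ht i) (log_nonpos_of_mem_Breg hx i)

theorem measurable_mellinKernel (J : Finset (Fin n)) (t : Fin n → ℂ) :
    Measurable (mellinKernel J t) :=
  ((sgnJ_bddMeas J).1.mul (measurable_multiPow t)).indicator measurableSet_Breg

theorem norm_mellinKernel_le (J : Finset (Fin n)) {t : Fin n → ℂ} (ht : ∀ i, 0 ≤ (t i).re)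
    (x : Fin n → ℝ) : ‖mellinKernel J t x‖ ≤ 1 := by
  by_cases hx : x ∈ Breg n
  · rw [mellinKernel, Set.indicator_of_mem hx, norm_mul]
    exact mul_le_one₀ (norm_sgnJ_le J x) (norm_nonneg _) (norm_multiPow_le ht hx)
  · rw [mellinKernel, Set.indicator_of_notMem hx, norm_zero]
    exact zero_le_one

theorem mellinKernel_bddMeas (J : Finset (Fin n)) {t : Fin n → ℂ} (ht : ∀ i, 0 ≤ (t i).re) :
    BddMeas (mellinKernel J t) :=
  ⟨measurable_mellinKernel J t, 1, norm_mellinKernel_le J ht⟩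

theorem multiPow_mul (t : Fin n → ℂ) {x y : Fin n → ℝ} (hx : ∀ i, x i ≠ 0) (hy : ∀ i, y i ≠ 0) :
    multiPow t (x * y) = multiPow t x * multiPow t y := by
  rw [multiPow, multiPow, multiPow, ← Complex.exp_add, ← Finset.sum_add_distrib]
  congr 1
  refine Finset.sum_congr rfl fun i _ => ?_
  rw [Pi.mul_apply, Real.log_mul (hx i) (hy i)]
  push_cast
  ring

theorem multiPow_smul {t : Fin n → ℂ} (ht : ∑ i, t i = 1) {c : ℝ} (hc : 0 < c)
    {x : Fin n → ℝ} (hx : ∀ i, x i ≠ 0) : multiPow t (c • x) = c * multiPow t x := by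
  have e : (c : ℂ) = Complex.exp (Real.log c : ℝ) := by
    rw [← Complex.ofReal_exp, Real.exp_log hc]
  rw [multiPow, multiPow, e, ← Complex.exp_add]
  congr 1
  have : ∑ i, t i * (Real.log c : ℂ) = Real.log c := by rw [← Finset.sum_mul, ht, one_mul]
  rw [← this, ← Finset.sum_add_distrib]
  refine Finset.sum_congr rfl fun i _ => ?_
  rw [Pi.smul_apply, smul_eq_mul, Real.log_mul hc.ne' (hx i)]
  push_cast
  ring

theorem e2_pos (hn : 1 ≤ n) {x : Fin n → ℝ} (hx : ∀ i, x i ≠ 0) : 0 < e2 x := by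
  have : Nonempty (Fin n) := ⟨⟨0, hn⟩⟩
  exact Real.sqrt_pos.2 (Finset.sum_pos (fun i _ => by have := hx i; positivity)
    Finset.univ_nonempty)

theorem normalize_mem_Breg (hn : 1 ≤ n) {x : Fin n → ℝ} (hx : ∀ i, x i ≠ 0) :
    (e2 x)⁻¹ • x ∈ Breg n := by
  have h := e2_pos hn hx
  refine ⟨fun i => ?_, ?_⟩
  · simpa using ⟨h.ne', hx i⟩
  · change e2 _ = 1
    rw [e2_smul (inv_nonneg.2 h.le), inv_mul_cancel₀ h.ne']

theorem homExt_mellinKernel (hn : 1 ≤ n) (J : Finset (Fin n)) {t : Fin n → ℂ}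
    (ht : ∑ i, t i = 1) {x y : Fin n → ℝ} (hx : x ∈ Breg n) (hy : y ∈ Breg n) :
    homExt (mellinKernel J t) (x * y) = mellinKernel J t x * mellinKernel J t y := by
  have hx0 := ne_zero_of_mem_Breg hx
  have hy0 := ne_zero_of_mem_Breg hy
  have hxy : ∀ i, (x * y) i ≠ 0 := fun i => mul_ne_zero (hx0 i) (hy0 i)
  have hpos := e2_pos hn hxy
  have hle : e2 (x * y) ≤ 1 :=
    (e2_mul_le (abs_le_of_mem_Breg hx)).trans (e2_of_mem_Breg hy).le
  rw [homExt, Set.indicator_of_mem (by exact hle), mellinKernel,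
    Set.indicator_of_mem (normalize_mem_Breg hn hxy), Set.indicator_of_mem hx,
    Set.indicator_of_mem hy, sgnJ_smul J (inv_pos.2 hpos), multiPow_smul ht (inv_pos.2 hpos) hxy,
    sgnJ_mul, multiPow_mul t hx0 hy0]
  have : ((e2 (x * y) : ℝ) : ℂ) ≠ 0 := by exact_mod_cast hpos.ne'
  push_cast
  field_simp

theorem cInt_mellinKernel_mul (hn : 1 ≤ n) {ν μ : SM n} (hν : ConcOn ν (Breg n))
    (hμ : ConcOn μ (Breg n)) (h : mconvS ν μ = 0) (J : Finset (Fin n)) {t : Fin n → ℂ}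
    (ht : ∑ i, t i = 1) (ht0 : ∀ i, 0 ≤ (t i).re) :
    cInt ν (mellinKernel J t) * cInt μ (mellinKernel J t) = 0 := by
  have h1 := cInt_mconvS hν hμ (fun x hx y hy =>
    (e2_mul_le (abs_le_of_mem_Breg hx)).trans (e2_of_mem_Breg hy).le) (mellinKernel_bddMeas J ht0)
  rw [h, cInt_zero, cInt_congr hν (g := fun x => cInt μ (mellinKernel J t) *
    mellinKernel J t x), cInt_mul_left] at h1
  · rw [mul_comm, ← h1]
  · intro x hx
    rw [cInt_congr hμ fun y hy => homExt_mellinKernel hn J ht hx hy, cInt_mul_left, mul_comm]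

theorem hasDerivAt_mellinKernel (J : Finset (Fin n)) (a b : Fin n → ℂ) (z : ℂ)
    (x : Fin n → ℝ) : HasDerivAt (fun z => mellinKernel J (fun i => a i + z * b i) x)
      (mellinKernel J (fun i => a i + z * b i) x * ∑ i, b i * (Real.log (x i) : ℂ)) z := by
  by_cases hx : x ∈ Breg n
  · simp only [mellinKernel, Set.indicator_of_mem hx, multiPow]
    rw [mul_assoc]
    refine HasDerivAt.const_mul _ (HasDerivAt.cexp (HasDerivAt.fun_sum fun i _ => ?_))
    refine HasDerivAt.mul_const ?_ _
    simpa using ((hasDerivAt_id z).mul_const (b i)).const_add (a i)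
  · simp only [mellinKernel, Set.indicator_of_notMem hx, zero_mul]
    exact hasDerivAt_const z 0

/-- The half-space region on which the Mellin transform is holomorphic along a complex line. -/
def mellinDomain (a b : Fin n → ℂ) : Set ℂ := {z | ∀ i, 0 < (a i + z * b i).re}

theorem isOpen_mellinDomain (a b : Fin n → ℂ) : IsOpen (mellinDomain a b) := by
  have : mellinDomain a b = ⋂ i, {z | 0 < (a i + z * b i).re} := by
    ext z
    simp [mellinDomain]
  rw [this]
  exact isOpen_iInter_of_finite fun i => isOpen_lt continuous_const (by fun_prop)

theorem convex_mellinDomain (a b : Fin n → ℂ) : Convex ℝ (mellinDomain a b) := by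
  intro z hz w hw r s hr hs hrs i
  have h1 := hz i
  have h2 := hw i
  have e : (a i + (r • z + s • w) * b i).re =
      r * (a i + z * b i).re + s * (a i + w * b i).re := by
    simp only [Complex.add_re, Complex.mul_re, Complex.add_im, Complex.smul_re, Complex.smul_im,
      smul_eq_mul]
    linear_combination (-(a i).re) * hrs
  rw [e]
  rcases hr.eq_or_lt with rfl | hr
  · have : s = 1 := by linarith
    subst this
    simpa using h2
  · have := mul_pos hr h1
    have := mul_nonneg hs h2.le
    linarith

theorem analyticOnNhd_cInt_mellinKernel (μ : SM n) (J : Finset (Fin n)) (a b : Fin n → ℂ) :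
    AnalyticOnNhd ℂ (fun z => cInt μ (mellinKernel J fun i => a i + z * b i))
      (mellinDomain a b) := by
  refine DifferentiableOn.analyticOnNhd ?_ (isOpen_mellinDomain a b)
  have hm (z : ℂ) : Measurable fun x => mellinKernel J (fun i => a i + z * b i) x *
      ∑ i, b i * (Real.log (x i) : ℂ) := by
    refine (measurable_mellinKernel J _).mul (Finset.measurable_sum _ fun i _ => ?_)
    exact (Complex.measurable_ofReal.comp
      (Real.measurable_log.comp (measurable_pi_apply i))).const_mul _
  have key (p : Measure (Fin n → ℝ)) [IsFiniteMeasure p] : DifferentiableOn ℂ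
      (fun z => ∫ x, mellinKernel J (fun i => a i + z * b i) x ∂p) (mellinDomain a b) :=
    differentiableOn_integral_of_bounded (isOpen_mellinDomain a b)
      (fun z => measurable_mellinKernel J _) hm
      (fun z hz => norm_mellinKernel_le J fun i => (hz i).le)
      (fun z x => hasDerivAt_mellinKernel J a b z x)
  exact (key _).sub (key _)

/-- The Mellin transform of one of the two factors of a vanishing spherical product vanishes. -/
theorem cInt_mellinKernel_eq_zero (hn : 1 ≤ n) {ν μ : SM n} (hν : ConcOn ν (Breg n))
    (hμ : ConcOn μ (Breg n)) (h : mconvS ν μ = 0) (J : Finset (Fin n)) :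
    (∀ t : Fin n → ℂ, ∑ i, t i = 1 → (∀ i, 0 < (t i).re) → cInt ν (mellinKernel J t) = 0) ∨
      ∀ t : Fin n → ℂ, ∑ i, t i = 1 → (∀ i, 0 < (t i).re) → cInt μ (mellinKernel J t) = 0 := by
  by_contra! hcon
  obtain ⟨⟨a, ha, ha0, hνa⟩, c, hc, hc0, hμc⟩ := hcon
  have h0 : (0 : ℂ) ∈ mellinDomain a (c - a) := fun i => by simpa using ha0 i
  have h1 : (1 : ℂ) ∈ mellinDomain a (c - a) := fun i => by simpa using hc0 i
  rcases (analyticOnNhd_cInt_mellinKernel ν J a (c - a)).eq_zero_or_eq_zero_of_mul_eq_zero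
    (analyticOnNhd_cInt_mellinKernel μ J a (c - a))
    (fun z hz => cInt_mellinKernel_mul hn hν hμ h J
      (by simp [Finset.sum_add_distrib, ← Finset.mul_sum, ha, hc]) fun i => (hz i).le)
    (convex_mellinDomain a (c - a)).isPreconnected with h2 | h2
  · exact hνa (by simpa using h2 0 h0)
  · exact hμc (by simpa using h2 1 h1)


end Mellin

section GeneratingPairs

variable {n : ℕ}

/-- The indicator vector over `𝔽₂` of a set together with a parity. -/
def parityVec (G : Finset (Fin n)) (odd : Bool) : (Fin n → ZMod 2) × ZMod 2 :=
  (fun i => if i ∈ G then 1 else 0, if odd then 1 else 0)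

theorem parityVec_symmDiff (G H : Finset (Fin n)) (a b : Bool) :
    parityVec (G ∆ H) (a ^^ b) = parityVec G a + parityVec H b := by
  refine Prod.ext (funext fun i => ?_) ?_
  · by_cases hG : i ∈ G <;> by_cases hH : i ∈ H <;>
      simp [parityVec, Finset.mem_symmDiff, hG, hH]
    decide
  · cases a <;> cases b <;> simp [parityVec]
    decide

theorem parityVec_injective {G H : Finset (Fin n)} {a b : Bool}
    (h : parityVec G a = parityVec H b) : G = H ∧ a = b := by
  rw [parityVec, parityVec, Prod.mk.injEq] at h
  constructor
  · ext i
    have := congrFun h.1 i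
    by_cases hG : i ∈ G <;> by_cases hH : i ∈ H <;> simp_all
  · have := h.2
    cases a <;> cases b <;> simp_all

theorem HasRep.mul {Fe Fo : Set (Finset (Fin n))} {G H : Finset (Fin n)} {a b : Bool}
    (hG : HasRep Fe Fo G a) (hH : HasRep Fe Fo H b) : HasRep Fe Fo (G ∆ H) (a ^^ b) := by
  obtain ⟨l, h1, h2, h3⟩ := hG
  obtain ⟨m, k1, k2, k3⟩ := hH
  refine ⟨l ++ m, fun p hp => (List.mem_append.1 hp).elim (h1 p) (k1 p), ?_, ?_⟩
  · rw [List.map_append, List.foldr_append, k2, ← h2]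
    generalize l.map Prod.fst = l'
    induction l' with
    | nil => exact (bot_symmDiff H).symm
    | cons c l' ih => rw [List.foldr_cons, List.foldr_cons, ih, symmDiff_assoc]
  · rw [List.countP_append, Nat.add_mod, h3, k3]
    cases a <;> cases b <;> rfl

/-- The `𝔽₂`-subspace of parity vectors of represented sets. -/
def repSpan (Fe Fo : Set (Finset (Fin n))) : Submodule (ZMod 2) ((Fin n → ZMod 2) × ZMod 2) where
  carrier := {v | ∃ G a, HasRep Fe Fo G a ∧ parityVec G a = v}
  zero_mem' := ⟨∅, false, ⟨[], by simp⟩, by ext <;> simp [parityVec]⟩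
  add_mem' := by
    rintro _ _ ⟨G, a, hG, rfl⟩ ⟨H, b, hH, rfl⟩
    exact ⟨_, _, hG.mul hH, parityVec_symmDiff G H a b⟩
  smul_mem' := by
    rintro c _ ⟨G, a, hG, rfl⟩
    obtain rfl | rfl : c = 0 ∨ c = 1 := by revert c; decide
    · exact ⟨∅, false, ⟨[], by simp⟩, by ext <;> simp [parityVec]⟩
    · exact ⟨G, a, hG, (one_smul _ _).symm⟩

theorem parityVec_mem_repSpan {Fe Fo : Set (Finset (Fin n))} {G : Finset (Fin n)} {a : Bool} :
    parityVec G a ∈ repSpan Fe Fo ↔ HasRep Fe Fo G a := by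
  refine ⟨?_, fun h => ⟨G, a, h, rfl⟩⟩
  rintro ⟨H, b, hH, h⟩
  obtain ⟨rfl, rfl⟩ := parityVec_injective h
  exact hH

theorem hasRep_of_mem {Fe Fo : Set (Finset (Fin n))} {F : Finset (Fin n)} {a : Bool}
    (h : if a then F ∈ Fo else F ∈ Fe) : HasRep Fe Fo F a :=
  ⟨[(F, a)], by simpa using h, by simp, by cases a <;> simp⟩

/-- If `E` is not represented with parity `a`, some `J ∈ 𝒥(Fe, Fo)` meets `E` in a set whose
cardinality has the parity opposite to `a`. -/
theorem exists_mem_Jset {Fe Fo : Set (Finset (Fin n))} (hproper : ProperPair Fe Fo)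
    {E : Finset (Fin n)} {a : Bool} (hE : ¬ HasRep Fe Fo E a) :
    ∃ J ∈ Jset Fe Fo, if a then Even (J ∩ E).card else Odd (J ∩ E).card := by
  have hrep0 : HasRep Fe Fo ∅ false := ⟨[], by simp⟩
  set W := repSpan Fe Fo
  have hv : parityVec (∅ : Finset (Fin n)) true ∉ W ⊔ Submodule.span _ {parityVec E (!a)} := by
    rw [Submodule.mem_sup]
    rintro ⟨w, hw, u, hu, h⟩
    obtain ⟨c, rfl⟩ := Submodule.mem_span_singleton.1 hu
    obtain rfl | rfl := (by decide : ∀ c : ZMod 2, c = 0 ∨ c = 1) c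
    · rw [zero_smul, add_zero] at h
      rw [h] at hw
      exact hproper ∅ ⟨hrep0, parityVec_mem_repSpan.1 hw⟩
    · have e : w = parityVec E a := by
        rw [one_smul] at h
        have h2 : parityVec (∅ : Finset (Fin n)) true = parityVec E a + parityVec E (!a) := by
          rw [← parityVec_symmDiff, symmDiff_self]
          cases a <;> rfl
        exact add_right_cancel (h.trans h2)
      rw [e] at hw
      exact hE (parityVec_mem_repSpan.1 hw)
  obtain ⟨φ, hφ, hker⟩ := Submodule.exists_le_ker_of_notMem hv
  have hφ1 : φ (parityVec ∅ true) = 1 := by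
    have : ∀ c : ZMod 2, c ≠ 0 → c = 1 := by decide
    exact this _ hφ
  set J : Finset (Fin n) := Finset.univ.filter fun i => φ (Pi.single i 1, 0) = 1 with hJ
  have key (G : Finset (Fin n)) (b : Bool) :
      φ (parityVec G b) = ((J ∩ G).card : ZMod 2) + if b then 1 else 0 := by
    have e : parityVec G b = ∑ i ∈ G, ((Pi.single i 1, 0) : (Fin n → ZMod 2) × ZMod 2) +
        (if b then (1 : ZMod 2) else 0) • parityVec ∅ true := by
      refine Prod.ext (funext fun i => ?_) ?_
      · cases b <;> simp [parityVec, Prod.fst_sum, Finset.sum_apply, Pi.single_apply]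
      · cases b <;> simp [parityVec, Prod.snd_sum]
    have h1 (i : Fin n) : φ (Pi.single i 1, 0) = if i ∈ J then 1 else 0 := by
      by_cases h : φ (Pi.single i 1, 0) = 1
      · simp [hJ, h]
      · have : ∀ c : ZMod 2, c ≠ 1 → c = 0 := by decide
        simp [hJ, this _ h]
    rw [e, map_add, map_sum, map_smul, hφ1, smul_eq_mul, mul_one]
    simp only [h1]
    rw [Finset.sum_ite_mem, Finset.inter_comm, Finset.sum_const, nsmul_eq_mul, mul_one]
  have hW {G : Finset (Fin n)} {b : Bool} (h : HasRep Fe Fo G b) : φ (parityVec G b) = 0 :=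
    hker (Submodule.mem_sup_left (parityVec_mem_repSpan.2 h))
  have hE0 : φ (parityVec E (!a)) = 0 :=
    hker (Submodule.mem_sup_right (Submodule.mem_span_singleton_self _))
  have even_of {k : ℕ} (h : (k : ZMod 2) + 0 = 0) : Even k := by
    rwa [add_zero, ZMod.natCast_eq_zero_iff_even] at h
  have odd_of {k : ℕ} (h : (k : ZMod 2) + 1 = 0) : Odd k := by
    rw [← ZMod.natCast_eq_one_iff_odd]
    exact (by decide : ∀ c : ZMod 2, c + 1 = 0 → c = 1) _ h
  refine ⟨J, ⟨fun F hF => ?_, fun F hF => ?_⟩, ?_⟩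
  · exact even_of ((key F false).symm.trans (hW (hasRep_of_mem (a := false) hF)))
  · exact odd_of ((key F true).symm.trans (hW (hasRep_of_mem (a := true) hF)))
  · cases a
    · exact odd_of ((key E true).symm.trans hE0)
    · exact even_of ((key E false).symm.trans hE0)

end GeneratingPairs

section Uniqueness

variable {n : ℕ}

/-- The mean of the logarithms of the coordinates of a vector. -/
def meanLog (x : Fin n → ℝ) : ℝ := (∑ i, Real.log (x i)) / n

/-- The logarithms of the coordinates of a vector, centred at their mean. -/
def centredLog (x : Fin n → ℝ) : EuclideanSpace ℝ (Fin n) :=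
  WithLp.toLp 2 fun i => Real.log (x i) - meanLog x

/-- The exponentials of the coordinates of a vector, projected to the sphere. -/
def sphExp (v : EuclideanSpace ℝ (Fin n)) : Fin n → ℝ :=
  (e2 fun i => Real.exp (v i))⁻¹ • fun i => Real.exp (v i)

theorem measurable_meanLog : Measurable (meanLog : (Fin n → ℝ) → ℝ) := by
  unfold meanLog
  fun_prop

theorem measurable_centredLog : Measurable (centredLog : (Fin n → ℝ) → _) := by
  have h := measurable_meanLog (n := n)
  refine (WithLp.measurable_toLp 2 _).comp (measurable_pi_lambda _ fun i => ?_)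
  exact (Real.measurable_log.comp (measurable_pi_apply i)).sub h

theorem measurable_sphExp : Measurable (sphExp : EuclideanSpace ℝ (Fin n) → _) := by
  have h : Measurable fun (v : EuclideanSpace ℝ (Fin n)) i => Real.exp (v i) := by fun_prop
  exact measurable_normalize.comp h

theorem e2_absV (x : Fin n → ℝ) : e2 (absV x) = e2 x := by
  simp only [e2, absV, sq_abs]

theorem sphExp_centredLog {x : Fin n → ℝ} (hx : x ∈ Breg n) : sphExp (centredLog x) = absV x := by
  have h : (fun i => Real.exp (centredLog x i)) = Real.exp (-meanLog x) • absV x := by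
    ext i
    have h0 := abs_pos.2 (ne_zero_of_mem_Breg hx i)
    simp only [centredLog, Pi.smul_apply, smul_eq_mul, absV]
    rw [sub_eq_neg_add, Real.exp_add, ← Real.log_abs, Real.exp_log h0]
  rw [sphExp, h, e2_smul (Real.exp_pos _).le, e2_absV, e2_of_mem_Breg hx, mul_one,
    inv_smul_smul₀ (Real.exp_pos _).ne']

theorem meanLog_absV (x : Fin n → ℝ) : meanLog (absV x) = meanLog x := by
  simp only [meanLog, absV, Real.log_abs]

theorem meanLog_nonpos {x : Fin n → ℝ} (hx : x ∈ Breg n) : meanLog x ≤ 0 :=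
  div_nonpos_of_nonpos_of_nonneg (Finset.sum_nonpos fun i _ => log_nonpos_of_mem_Breg hx i)
    (Nat.cast_nonneg n)

/-- The image under `centredLog` of a measure weighted by the geometric mean of coordinates. -/
def logImage (m : Measure (Fin n → ℝ)) : Measure (EuclideanSpace ℝ (Fin n)) :=
  (m.withDensity fun x => ENNReal.ofReal (Real.exp (meanLog x))).map centredLog

theorem isFiniteMeasure_logImage {m : Measure (Fin n → ℝ)} [IsFiniteMeasure m]
    (hm : ∀ᵐ x ∂m, x ∈ Breg n) : IsFiniteMeasure (logImage m) := by
  have : IsFiniteMeasure (m.withDensity fun x => ENNReal.ofReal (Real.exp (meanLog x))) := by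
    refine isFiniteMeasure_withDensity (ne_of_lt ?_)
    refine lt_of_le_of_lt (lintegral_mono_ae (g := fun _ => 1) ?_) ?_
    · exact hm.mono fun x hx => by
        simpa using meanLog_nonpos hx
    · simp
  unfold logImage
  infer_instance

theorem integral_logImage (m : Measure (Fin n → ℝ)) {k : EuclideanSpace ℝ (Fin n) → ℂ}
    (hk : Measurable k) :
    ∫ v, k v ∂(logImage m) = ∫ x, (Real.exp (meanLog x) : ℂ) * k (centredLog x) ∂m := by
  rw [logImage, integral_map measurable_centredLog.aemeasurable hk.aestronglyMeasurable,
    integral_withDensity_eq_integral_toReal_smul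
      (measurable_meanLog.exp.ennreal_ofReal)
      (Filter.Eventually.of_forall fun _ => ENNReal.ofReal_lt_top)]
  refine integral_congr_ae (Filter.Eventually.of_forall fun x => ?_)
  simp only
  rw [ENNReal.toReal_ofReal (Real.exp_pos _).le, Complex.real_smul]

theorem integral_absV_eq_integral_logImage {m : Measure (Fin n → ℝ)}
    (hm : ∀ᵐ x ∂m, x ∈ Breg n) {h : (Fin n → ℝ) → ℂ} (hh : Measurable h) :
    ∫ x, h (absV x) ∂m =
      ∫ v, (Real.exp (-meanLog (sphExp v)) : ℂ) * h (sphExp v) ∂(logImage m) := by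
  rw [integral_logImage]
  · refine integral_congr_ae (hm.mono fun x hx => ?_)
    simp only
    rw [sphExp_centredLog hx, meanLog_absV, ← mul_assoc, ← Complex.ofReal_mul, ← Real.exp_add,
      add_neg_cancel, Real.exp_zero, Complex.ofReal_one, one_mul]
  · exact (Complex.measurable_ofReal.comp (measurable_meanLog.comp measurable_sphExp).neg.exp).mul
      (hh.comp measurable_sphExp)

/-- The Mellin exponents on the critical line that correspond to a frequency `ξ`. -/
def lineExponent (ξ : EuclideanSpace ℝ (Fin n)) (i : Fin n) : ℂ :=
  (n : ℂ)⁻¹ + ((ξ i - (∑ j, ξ j) / n : ℝ) : ℂ) * Complex.I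

theorem sum_lineExponent (hn : 1 ≤ n) (ξ : EuclideanSpace ℝ (Fin n)) :
    ∑ i, lineExponent ξ i = 1 := by
  have h : (n : ℂ) ≠ 0 := by exact_mod_cast (by omega : n ≠ 0)
  have h' : (n : ℝ) ≠ 0 := by exact_mod_cast (by omega : n ≠ 0)
  have h2 : ∑ i, (ξ i - (∑ j, ξ j) / n) = 0 := by
    rw [Finset.sum_sub_distrib]
    simp
    field_simp
    ring
  simp only [lineExponent]
  rw [Finset.sum_add_distrib, ← Finset.sum_mul, ← Complex.ofReal_sum, h2]
  simp [h]

theorem re_lineExponent_pos (hn : 1 ≤ n) (ξ : EuclideanSpace ℝ (Fin n)) (i : Fin n) :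
    0 < (lineExponent ξ i).re := by
  have h : (0 : ℝ) < n := by exact_mod_cast hn
  have e : (lineExponent ξ i).re = (n : ℝ)⁻¹ := by
    rw [lineExponent, Complex.add_re, Complex.re_ofReal_mul, Complex.I_re, mul_zero, add_zero,
      ← Complex.ofReal_natCast, ← Complex.ofReal_inv, Complex.ofReal_re]
  rw [e]
  positivity

theorem multiPow_lineExponent (ξ : EuclideanSpace ℝ (Fin n)) (x : Fin n → ℝ) :
    multiPow (lineExponent ξ) x =
      (Real.exp (meanLog x) : ℂ) * Complex.exp (inner ℝ (centredLog x) ξ * Complex.I) := by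
  have h : inner ℝ (centredLog x) ξ = ∑ i, (ξ i - (∑ j, ξ j) / n) * Real.log (x i) := by
    rw [PiLp.inner_apply]
    simp only [centredLog, RCLike.inner_apply, conj_trivial, mul_sub, sub_mul,
      Finset.sum_sub_distrib, ← Finset.sum_mul, ← Finset.mul_sum, meanLog]
    ring
  rw [h, multiPow, Complex.ofReal_exp, ← Complex.exp_add]
  congr 1
  simp only [lineExponent, add_mul, Finset.sum_add_distrib, ← Finset.mul_sum, meanLog]
  push_cast
  rw [Finset.sum_mul]
  congr 1
  · rw [div_eq_inv_mul]
  · exact Finset.sum_congr rfl fun i _ => by ring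

theorem charFun_logImage {m : Measure (Fin n → ℝ)} (hm : ∀ᵐ x ∂m, x ∈ Breg n)
    (ξ : EuclideanSpace ℝ (Fin n)) :
    charFun (logImage m) ξ = ∫ x, mellinKernel ∅ (lineExponent ξ) x ∂m := by
  rw [charFun_apply, integral_logImage m (by fun_prop)]
  refine integral_congr_ae (hm.mono fun x hx => ?_)
  simp only
  rw [mellinKernel, Set.indicator_of_mem hx, multiPow_lineExponent]
  simp [sgnJ]

/-- The total mass that `μ` twisted by `σ_J` assigns with a positive sign. -/
def twistPos (J : Finset (Fin n)) (μ : SM n) : Measure (Fin n → ℝ) :=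
  μ.toJordanDecomposition.posPart.restrict {x | sgnJ J x = 1} +
    μ.toJordanDecomposition.negPart.restrict {x | sgnJ J x = 1}ᶜ

/-- The total mass that `μ` twisted by `σ_J` assigns with a negative sign. -/
def twistNeg (J : Finset (Fin n)) (μ : SM n) : Measure (Fin n → ℝ) :=
  μ.toJordanDecomposition.posPart.restrict {x | sgnJ J x = 1}ᶜ +
    μ.toJordanDecomposition.negPart.restrict {x | sgnJ J x = 1}

instance (J : Finset (Fin n)) (μ : SM n) : IsFiniteMeasure (twistPos J μ) := by
  unfold twistPos
  infer_instance

instance (J : Finset (Fin n)) (μ : SM n) : IsFiniteMeasure (twistNeg J μ) := by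
  unfold twistNeg
  infer_instance

theorem ae_mem_twistPos {μ : SM n} (hμ : ConcOn μ (Breg n)) (J : Finset (Fin n)) :
    ∀ᵐ x ∂(twistPos J μ), x ∈ Breg n := by
  obtain ⟨h1, h2⟩ := ae_of_totalVariation hμ
  exact ae_add_measure_iff.2 ⟨ae_restrict_of_ae h1, ae_restrict_of_ae h2⟩

theorem ae_mem_twistNeg {μ : SM n} (hμ : ConcOn μ (Breg n)) (J : Finset (Fin n)) :
    ∀ᵐ x ∂(twistNeg J μ), x ∈ Breg n := by
  obtain ⟨h1, h2⟩ := ae_of_totalVariation hμ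
  exact ae_add_measure_iff.2 ⟨ae_restrict_of_ae h1, ae_restrict_of_ae h2⟩

theorem cInt_sgnJ_mul {μ : SM n} (hμ : ConcOn μ (Breg n)) (J : Finset (Fin n))
    {k : (Fin n → ℝ) → ℂ} (hk : BddMeas k) :
    cInt μ (fun x => sgnJ J x * k x) = ∫ x, k x ∂(twistPos J μ) - ∫ x, k x ∂(twistNeg J μ) := by
  obtain ⟨h1, h2⟩ := ae_of_totalVariation hμ
  have hP : MeasurableSet {x : Fin n → ℝ | sgnJ J x = 1} :=
    (sgnJ_bddMeas J).1 (measurableSet_singleton 1)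
  have key (p : Measure (Fin n → ℝ)) [IsFiniteMeasure p] (hp : ∀ᵐ x ∂p, x ∈ Breg n) :
      ∫ x, sgnJ J x * k x ∂p =
        ∫ x in {x | sgnJ J x = 1}, k x ∂p - ∫ x in {x | sgnJ J x = 1}ᶜ, k x ∂p := by
    rw [← integral_add_compl hP (((sgnJ_bddMeas J).mul hk).integrable p), sub_eq_add_neg,
      ← integral_neg]
    congr 1
    · refine setIntegral_congr_fun hP fun x hx => ?_
      rw [show sgnJ J x = 1 from hx, one_mul]
    · refine setIntegral_congr_ae hP.compl (hp.mono fun x hx hxP => ?_)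
      rcases mul_self_eq_one_iff.1 (sgnJ_mul_self J (ne_zero_of_mem_Breg hx)) with h | h
      · exact absurd h hxP
      · rw [h, neg_one_mul]
  rw [cInt, key _ h1, key _ h2, twistPos, twistNeg,
    integral_add_measure (hk.integrable _) (hk.integrable _),
    integral_add_measure (hk.integrable _) (hk.integrable _)]
  ring

/-- Uniqueness for the Mellin transform of the `J`-component of a measure. -/
theorem nullComp_of_cInt_mellinKernel (hn : 1 ≤ n) {μ : SM n} (hμ : ConcOn μ (Breg n))
    {J : Finset (Fin n)}
    (h : ∀ t : Fin n → ℂ, ∑ i, t i = 1 → (∀ i, 0 < (t i).re) → cInt μ (mellinKernel J t) = 0) :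
    NullComp μ J := by
  have hp := ae_mem_twistPos hμ J
  have hq := ae_mem_twistNeg hμ J
  have := isFiniteMeasure_logImage hp
  have := isFiniteMeasure_logImage hq
  have heq : logImage (twistPos J μ) = logImage (twistNeg J μ) := by
    refine Measure.ext_of_charFun (funext fun ξ => ?_)
    have hpos := re_lineExponent_pos hn ξ
    rw [charFun_logImage hp, charFun_logImage hq, ← sub_eq_zero,
      ← cInt_sgnJ_mul hμ J (mellinKernel_bddMeas ∅ fun i => (hpos i).le),
      ← h _ (sum_lineExponent hn ξ) hpos]
    refine congrArg _ (funext fun x => ?_)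
    by_cases hx : x ∈ Breg n <;> simp [mellinKernel, hx, sgnJ]
  intro k hk
  rw [cInt_sgnJ_mul hμ J (hk.comp measurable_absV), integral_absV_eq_integral_logImage hp hk.1,
    integral_absV_eq_integral_logImage hq hk.1, heq, sub_self]

theorem nullComp_or_nullComp (hn : 1 ≤ n) {ν μ : SM n} (hν : ConcOn ν (Breg n))
    (hμ : ConcOn μ (Breg n)) (h : mconvS ν μ = 0) (J : Finset (Fin n)) :
    NullComp ν J ∨ NullComp μ J :=
  (cInt_mellinKernel_eq_zero hn hν hμ h J).imp (nullComp_of_cInt_mellinKernel hn hν)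
    (nullComp_of_cInt_mellinKernel hn hμ)

end Uniqueness

/-- Theorem: characterisation of spherical universality on `ℳ(B_{[n]}; Fe, Fo)` for a proper
generating pair, with the supplement on reflection symmetries of `ν`. -/
theorem stmt4 {n : ℕ} (hn : 1 ≤ n) (ν : SM n)
    (hconc : ConcOn ν (setA (Finset.univ : Finset (Fin n)) ∩ Sph n))
    (Fe Fo : Set (Finset (Fin n))) (hproper : ProperPair Fe Fo) :
    (SphUniversal ν
        {μ : SM n | ConcOn μ (setA (Finset.univ : Finset (Fin n)) ∩ Sph n) ∧
          (∀ F ∈ Fe, EvenUnder μ F) ∧ (∀ F ∈ Fo, OddUnder μ F)} ↔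
      ∀ J ∈ Jset Fe Fo, mconvS (deltaJ J) ν ≠ 0) ∧
    (SphUniversal ν
        {μ : SM n | ConcOn μ (setA (Finset.univ : Finset (Fin n)) ∩ Sph n) ∧
          (∀ F ∈ Fe, EvenUnder μ F) ∧ (∀ F ∈ Fo, OddUnder μ F)} →
      ∀ E : Finset (Fin n),
        (EvenUnder ν E → HasRep Fe Fo E false) ∧
        (OddUnder ν E → HasRep Fe Fo E true)) := by
  set 𝒜 : Set (SM n) := {μ : SM n | ConcOn μ (Breg n) ∧ (∀ F ∈ Fe, EvenUnder μ F) ∧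
    ∀ F ∈ Fo, OddUnder μ F}
  have necessary (hu : SphUniversal ν 𝒜) : ∀ J ∈ Jset Fe Fo, mconvS (deltaJ J) ν ≠ 0 := by
    intro J hJ h
    have hn1 : (1 : ℝ) ≤ n := by exact_mod_cast hn
    refine dilatedDeltaJ_ne_zero (inv_pos.2 (Real.sqrt_pos.2 (by linarith))) J (hu _
      ⟨concOn_Breg_dilatedDeltaJ hn J, fun F hF => evenUnder_dilatedDeltaJ _ (hJ.1 F hF),
        fun F hF => oddUnder_dilatedDeltaJ _ (hJ.2 F hF)⟩ ?_)
    exact mconvS_dilatedDeltaJ_eq_zero hconc h (inv_pos.2 (Real.sqrt_pos.2 (by linarith)))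
      (inv_le_one_of_one_le₀ (Real.one_le_sqrt.2 hn1))
  refine ⟨⟨necessary, fun hδ μ hμ h0 => ?_⟩, fun hu E => ⟨fun hE => ?_, fun hE => ?_⟩⟩
  · obtain ⟨hμc, hμe, hμo⟩ := hμ
    refine eq_zero_of_nullComp hμc fun J => ?_
    by_cases hJ : J ∈ Jset Fe Fo
    · exact (nullComp_or_nullComp hn hconc hμc h0 J).resolve_left fun h =>
        hδ J hJ (mconvS_deltaJ_eq_zero hconc h)
    · rcases not_and_or.1 hJ with h | h
      · push Not at h
        obtain ⟨F, hF, hJF⟩ := h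
        exact nullComp_of_even (hμe F hF) (by simpa using hJF)
      · push Not at h
        obtain ⟨F, hF, hJF⟩ := h
        exact nullComp_of_odd (hμo F hF) (by simpa using hJF)
  · by_contra hrep
    obtain ⟨J, hJ, hJE⟩ := exists_mem_Jset hproper hrep
    exact necessary hu J hJ (mconvS_deltaJ_eq_zero hconc (nullComp_of_even hE (by simpa using hJE)))
  · by_contra hrep
    obtain ⟨J, hJ, hJE⟩ := exists_mem_Jset hproper hrep
    exact necessary hu J hJ (mconvS_deltaJ_eq_zero hconc (nullComp_of_odd hE (by simpa using hJE)))

end
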